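/- arXiv:1405.7166 — 2 statements merged into one kernel-verified Lean document; each statement's English description precedes it below -/
import Mathlib

section
/- Let N ≥ 1, s > 0, V > 0, A > 0, and let u : ℝ^N → ℝ be measurable with 0 < ∫_{ℝ^N} u(x)² dx < ∞. If A + (V − 1/s) ∫_{ℝ^N} u² dx < 0, then there exists a unique θ > 0 such that A + V ∫_{ℝ^N} u² dx = ∫_{ℝ^N} θ² u(x)⁴/(1 + s θ² u(x)²) dx. -/
open MeasureTheory

section SaturableNonlinearity

open Filter Topology

lemma saturable_nonneg {s : ℝ} (hs : 0 < s) (θ t : ℝ) :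
    0 ≤ θ ^ 2 * t ^ 4 / (1 + s * θ ^ 2 * t ^ 2) := by
  positivity

lemma saturable_eq_sub {s : ℝ} (hs : 0 < s) (θ t : ℝ) :
    θ ^ 2 * t ^ 4 / (1 + s * θ ^ 2 * t ^ 2) =
      t ^ 2 / s - t ^ 2 / s * (1 + s * θ ^ 2 * t ^ 2)⁻¹ := by
  have h : 1 + s * θ ^ 2 * t ^ 2 ≠ 0 := by positivity
  field_simp
  ring

lemma saturable_le {s : ℝ} (hs : 0 < s) (θ t : ℝ) :
    θ ^ 2 * t ^ 4 / (1 + s * θ ^ 2 * t ^ 2) ≤ t ^ 2 / s := by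
  rw [saturable_eq_sub hs]
  have h : 0 ≤ t ^ 2 / s * (1 + s * θ ^ 2 * t ^ 2)⁻¹ := by positivity
  linarith

lemma norm_saturable_le {s : ℝ} (hs : 0 < s) (θ t : ℝ) :
    ‖θ ^ 2 * t ^ 4 / (1 + s * θ ^ 2 * t ^ 2)‖ ≤ t ^ 2 / s := by
  rw [Real.norm_of_nonneg (saturable_nonneg hs θ t)]
  exact saturable_le hs θ t

lemma saturable_lt_saturable {s a b t : ℝ} (hs : 0 < s) (ha : 0 < a) (hab : a < b)
    (ht : t ≠ 0) :
    a ^ 2 * t ^ 4 / (1 + s * a ^ 2 * t ^ 2) < b ^ 2 * t ^ 4 / (1 + s * b ^ 2 * t ^ 2) := by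
  have hsq : a ^ 2 < b ^ 2 := by gcongr
  have ht2 : 0 < t ^ 2 := by positivity
  rw [saturable_eq_sub hs, saturable_eq_sub hs]
  gcongr

lemma tendsto_saturable_atTop {s : ℝ} (hs : 0 < s) (t : ℝ) :
    Tendsto (fun θ : ℝ => θ ^ 2 * t ^ 4 / (1 + s * θ ^ 2 * t ^ 2)) atTop (𝓝 (t ^ 2 / s)) := by
  rcases eq_or_ne t 0 with rfl | ht
  · simp
  have ht2 : 0 < t ^ 2 := by positivity
  have hden : Tendsto (fun θ : ℝ => 1 + s * θ ^ 2 * t ^ 2) atTop atTop :=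
    tendsto_atTop_add_const_left _ _
      (((tendsto_pow_atTop two_ne_zero).const_mul_atTop hs).atTop_mul_const ht2)
  simp_rw [saturable_eq_sub hs]
  simpa using tendsto_const_nhds.sub (hden.inv_tendsto_atTop.const_mul (t ^ 2 / s))

variable {α : Type*} [MeasurableSpace α] {μ : Measure α} {u : α → ℝ} {s : ℝ}

lemma aestronglyMeasurable_saturable (hu : Measurable u) (s θ : ℝ) :
    AEStronglyMeasurable (fun x => θ ^ 2 * u x ^ 4 / (1 + s * θ ^ 2 * u x ^ 2)) μ :=
  Measurable.aestronglyMeasurable (by fun_prop)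

lemma integrable_saturable (hs : 0 < s) (hu : Measurable u)
    (hu2 : Integrable (fun x => u x ^ 2) μ) (θ : ℝ) :
    Integrable (fun x => θ ^ 2 * u x ^ 4 / (1 + s * θ ^ 2 * u x ^ 2)) μ :=
  (hu2.div_const s).mono' (aestronglyMeasurable_saturable hu s θ)
    (ae_of_all _ fun x => norm_saturable_le hs θ (u x))

lemma continuous_integral_saturable (hs : 0 < s) (hu : Measurable u)
    (hu2 : Integrable (fun x => u x ^ 2) μ) :
    Continuous fun θ : ℝ => ∫ x, θ ^ 2 * u x ^ 4 / (1 + s * θ ^ 2 * u x ^ 2) ∂μ := by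
  refine continuous_of_dominated (fun θ => aestronglyMeasurable_saturable hu s θ)
    (fun θ => ae_of_all _ fun x => norm_saturable_le hs θ (u x)) (hu2.div_const s)
    (ae_of_all _ fun x => ?_)
  refine Continuous.div (by fun_prop) (by fun_prop) fun θ => ?_
  positivity

lemma tendsto_integral_saturable_atTop (hs : 0 < s) (hu : Measurable u)
    (hu2 : Integrable (fun x => u x ^ 2) μ) :
    Tendsto (fun θ : ℝ => ∫ x, θ ^ 2 * u x ^ 4 / (1 + s * θ ^ 2 * u x ^ 2) ∂μ) atTop
      (𝓝 ((∫ x, u x ^ 2 ∂μ) / s)) := by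
  rw [← integral_div]
  exact tendsto_integral_filter_of_dominated_convergence _
    (Eventually.of_forall fun θ => aestronglyMeasurable_saturable hu s θ)
    (Eventually.of_forall fun θ => ae_of_all _ fun x => norm_saturable_le hs θ (u x))
    (hu2.div_const s) (ae_of_all _ fun x => tendsto_saturable_atTop hs (u x))

lemma strictMonoOn_integral_saturable (hs : 0 < s) (hu : Measurable u)
    (hu2 : Integrable (fun x => u x ^ 2) μ) (hpos : 0 < ∫ x, u x ^ 2 ∂μ) :
    StrictMonoOn (fun θ : ℝ => ∫ x, θ ^ 2 * u x ^ 4 / (1 + s * θ ^ 2 * u x ^ 2) ∂μ)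
      (Set.Ioi 0) := by
  intro a ha b _ hab
  have hlt {t : ℝ} (ht : t ≠ 0) := saturable_lt_saturable hs ha hab ht
  have hle : ∀ x, a ^ 2 * u x ^ 4 / (1 + s * a ^ 2 * u x ^ 2) ≤
      b ^ 2 * u x ^ 4 / (1 + s * b ^ 2 * u x ^ 2) := fun x => by
    rcases eq_or_ne (u x) 0 with h | h
    · simp [h]
    · exact (hlt h).le
  have hIa := integrable_saturable hs hu hu2 a
  have hIb := integrable_saturable hs hu hu2 b
  refine (integral_mono hIa hIb hle).lt_of_ne fun heq => hpos.ne' ?_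
  have hae := (integral_eq_iff_of_ae_le hIa hIb (ae_of_all _ hle)).1 heq
  refine integral_eq_zero_of_ae ?_
  filter_upwards [hae] with x hx
  by_contra h
  exact (hlt fun h0 => h (by simp [h0])).ne hx

end SaturableNonlinearity

theorem stmt_13 (N : ℕ) (hN : 1 ≤ N) (s V A : ℝ)
    (hs : 0 < s) (hV : 0 < V) (hA : 0 < A)
    (u : EuclideanSpace ℝ (Fin N) → ℝ) (hu : Measurable u)
    (hu2 : Integrable (fun x => (u x)^2))
    (hu2pos : 0 < ∫ x, (u x)^2)
    (hneg : A + (V - 1 / s) * ∫ x, (u x)^2 < 0) :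
    ∃! θ : ℝ, 0 < θ ∧
      A + V * ∫ x, (u x)^2 = ∫ x, θ^2 * (u x)^4 / (1 + s * θ^2 * (u x)^2) := by
  have hlhs : 0 < A + V * ∫ x, (u x)^2 := by positivity
  have hlt : A + V * ∫ x, (u x)^2 < (∫ x, (u x)^2) / s := by
    have h : (V - 1 / s) * ∫ x, (u x)^2 = V * (∫ x, (u x)^2) - (∫ x, (u x)^2) / s := by ring
    linarith
  obtain ⟨b, hb, hb0⟩ := (((tendsto_integral_saturable_atTop hs hu hu2).eventually_const_lt
    hlt).and (Filter.eventually_gt_atTop 0)).exists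
  obtain ⟨θ, hθ, hθeq⟩ := intermediate_value_Ioo hb0.le
    (continuous_integral_saturable hs hu hu2).continuousOn
    (show A + V * ∫ x, (u x)^2 ∈ Set.Ioo _ _ from ⟨by simpa using hlhs, hb⟩)
  refine ⟨θ, ⟨hθ.1, hθeq.symm⟩, fun η ⟨hη, hηeq⟩ => ?_⟩
  exact (strictMonoOn_integral_saturable hs hu hu2 hu2pos).injOn hη hθ.1
    (hηeq.symm.trans hθeq.symm)
end

section
/- Let s > 0, c > 0 and λ ∈ (0, 1]. With f_s(t) = t³/(1 + s t²), F_s(t) = t²/(2s) − ln(1 + s t²)/(2s²), ḡ(t) = min(f_s(t), c t) for t ≥ 0 and ḡ(t) = 0 for t < 0, and Ḡ(t) = ∫₀ᵗ ḡ(ξ) dξ, define g(t) = λ f_s(t) + (1 − λ) ḡ(t) and G(t) = λ F_s(t) + (1 − λ) Ḡ(t). Then g(t) t − 2 G(t) ≥ λ ( f_s(t) t − 2 F_s(t) ) ≥ 0 for every t ∈ ℝ, and g(t) t − 2 G(t) → +∞ as |t| → ∞. -/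
open Filter

/-- If `φ ξ / ξ` is maximal on `(0, t]` at `ξ = t`, then `2 ∫₀ᵗ φ ≤ φ t * t`. -/
theorem two_mul_integral_le_of_mul_le_mul {φ : ℝ → ℝ} {t : ℝ} (ht : 0 ≤ t)
    (hφ : ContinuousOn φ (Set.Icc 0 t))
    (h : ∀ ξ ∈ Set.Icc 0 t, φ ξ * t ≤ φ t * ξ) :
    2 * ∫ ξ in (0:ℝ)..t, φ ξ ≤ φ t * t := by
  rcases ht.eq_or_lt with rfl | htpos
  · simp
  have hmono : ∫ ξ in (0:ℝ)..t, φ ξ * t ≤ ∫ ξ in (0:ℝ)..t, φ t * ξ := by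
    refine intervalIntegral.integral_mono_on ht ?_ ?_ h
    · exact (hφ.mul continuousOn_const).intervalIntegrable_of_Icc ht
    · exact (continuous_const.mul continuous_id).intervalIntegrable _ _
  rw [intervalIntegral.integral_mul_const, intervalIntegral.integral_const_mul,
    integral_id] at hmono
  refine le_of_mul_le_mul_right ?_ htpos
  linarith

/-- The quotient `t ↦ t ^ 2 / (1 + s * t ^ 2)` is increasing on `[0, ∞)`, in multiplied-out form. -/
theorem cube_div_mul_le {s x t : ℝ} (hs : 0 < s) (hx : 0 ≤ x) (hxt : x ≤ t) :
    x ^ 3 / (1 + s * x ^ 2) * t ≤ t ^ 3 / (1 + s * t ^ 2) * x := by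
  have ht := hx.trans hxt
  rw [div_mul_eq_mul_div, div_mul_eq_mul_div, div_le_div_iff₀ (by positivity) (by positivity)]
  have h : 0 ≤ x * t * (t ^ 2 - x ^ 2) :=
    mul_nonneg (mul_nonneg hx ht) (sub_nonneg.2 (pow_le_pow_left₀ hx hxt 2))
  linarith

theorem saturable_mul_sub_two_mul_primitive {s : ℝ} (hs : 0 < s) (t : ℝ) :
    t ^ 3 / (1 + s * t ^ 2) * t
        - 2 * (t ^ 2 / (2 * s) - Real.log (1 + s * t ^ 2) / (2 * s ^ 2)) =
      (Real.log (1 + s * t ^ 2) - (1 - (1 + s * t ^ 2)⁻¹)) / s ^ 2 := by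
  have hw : 1 + s * t ^ 2 ≠ 0 := by positivity
  field_simp
  ring

theorem tendsto_log_one_add_mul_sq {l : Filter ℝ} {s : ℝ} (hs : 0 < s)
    (hl : Tendsto (fun t : ℝ => t ^ 2) l atTop) :
    Tendsto (fun t : ℝ => Real.log (1 + s * t ^ 2)) l atTop :=
  Real.tendsto_log_atTop.comp (tendsto_atTop_add_const_left _ _ (hl.const_mul_atTop hs))

theorem stmt_15 (s c lam : ℝ) (hs : 0 < s) (hc : 0 < c)
    (hlam0 : 0 < lam) (hlam1 : lam ≤ 1)
    (f F gbar Gbar g G : ℝ → ℝ)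
    (hf : ∀ t : ℝ, f t = t^3 / (1 + s * t^2))
    (hF : ∀ t : ℝ, F t = t^2 / (2*s) - Real.log (1 + s * t^2) / (2*s^2))
    (hgbar : ∀ t : ℝ, gbar t = if 0 ≤ t then min (f t) (c * t) else 0)
    (hGbar : ∀ t : ℝ, Gbar t = ∫ ξ in (0:ℝ)..t, gbar ξ)
    (hg : ∀ t : ℝ, g t = lam * f t + (1 - lam) * gbar t)
    (hG : ∀ t : ℝ, G t = lam * F t + (1 - lam) * Gbar t) :
    (∀ t : ℝ, lam * (f t * t - 2 * F t) ≤ g t * t - 2 * G t ∧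
        0 ≤ lam * (f t * t - 2 * F t)) ∧
    Tendsto (fun t : ℝ => g t * t - 2 * G t) atTop atTop ∧
    Tendsto (fun t : ℝ => g t * t - 2 * G t) atBot atTop := by
  have hgbar_of_nonneg : ∀ t, 0 ≤ t → gbar t = min (f t) (c * t) := fun t ht => by
    rw [hgbar, if_pos ht]
  have hf_cont : Continuous f := by
    rw [funext hf]
    exact (continuous_id.pow 3).div (by fun_prop) fun t => by positivity
  have hbar : ∀ t, 2 * Gbar t ≤ gbar t * t := by
    intro t
    rw [hGbar]
    rcases le_or_gt 0 t with ht | ht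
    · refine two_mul_integral_le_of_mul_le_mul ht ?_ ?_
      · refine ContinuousOn.congr (f := fun t => min (f t) (c * t)) ?_
          fun x hx => hgbar_of_nonneg x hx.1
        exact (hf_cont.min (continuous_const.mul continuous_id)).continuousOn
      · rintro x ⟨hx, hxt⟩
        rw [hgbar_of_nonneg x hx, hgbar_of_nonneg t ht, min_mul_of_nonneg _ _ ht,
          min_mul_of_nonneg _ _ hx]
        refine min_le_min ?_ (by linarith)
        rw [hf, hf]
        exact cube_div_mul_le hs hx hxt
    · have hzero : ∫ ξ in (0:ℝ)..t, gbar ξ = 0 := by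
        rw [intervalIntegral.integral_symm, neg_eq_zero]
        refine intervalIntegral.integral_zero_ae ?_
        have hne : ∀ᵐ x : ℝ, x ≠ 0 := MeasureTheory.Measure.ae_ne MeasureTheory.volume 0
        filter_upwards [hne] with x hx0 hx
        rw [Set.uIoc_of_le ht.le] at hx
        rw [hgbar, if_neg (not_le.2 (lt_of_le_of_ne hx.2 hx0))]
      rw [hzero, hgbar, if_neg (not_le.2 ht)]
      simp
  have hlower : ∀ t, lam * (f t * t - 2 * F t) ≤ g t * t - 2 * G t := fun t => by
    have := mul_nonneg (sub_nonneg.2 hlam1) (sub_nonneg.2 (hbar t))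
    rw [hg, hG]
    linarith
  have hfF : ∀ t, f t * t - 2 * F t =
      (Real.log (1 + s * t ^ 2) - (1 - (1 + s * t ^ 2)⁻¹)) / s ^ 2 := fun t => by
    rw [hf, hF, saturable_mul_sub_two_mul_primitive hs]
  have hlim : ∀ l : Filter ℝ, Tendsto (fun t : ℝ => t ^ 2) l atTop →
      Tendsto (fun t : ℝ => g t * t - 2 * G t) l atTop := by
    intro l hl
    have hlog := ((tendsto_atTop_add_const_right l (-1)
      (tendsto_log_one_add_mul_sq hs hl)).atTop_div_const (pow_pos hs 2)).const_mul_atTop hlam0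
    refine tendsto_atTop_mono (fun t => le_trans ?_ (hlower t)) hlog
    rw [hfF]
    have hinv : 0 ≤ (1 + s * t ^ 2)⁻¹ := by positivity
    gcongr
    linarith
  refine ⟨fun t => ⟨hlower t, mul_nonneg hlam0.le ?_⟩, hlim _ (tendsto_pow_atTop two_ne_zero),
    hlim _ (by simpa [Function.comp_def] using
      (tendsto_pow_atTop (α := ℝ) two_ne_zero).comp tendsto_neg_atBot_atTop)⟩
  rw [hfF]
  have := Real.one_sub_inv_le_log_of_pos (show 0 < 1 + s * t ^ 2 by positivity)
  exact div_nonneg (sub_nonneg.2 this) (by positivity)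
end
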